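/- arXiv:2003.11457 — 2 statements merged into one kernel-verified Lean document; each statement's English description precedes it below -/
import Mathlib

section
/- For any quadruple (M_f, μ, R₀, ε̄) ∈ ℝ₊ × ℝ₊ × ℝ₊₊ × ℝ₊₊ there exist a dimension n ≥ 1, a point x₀ ∈ ℝⁿ, a finite-valued convex function f : ℝⁿ → ℝ, a map f' : ℝⁿ → ℝⁿ with f'(x) ∈ ∂f(x) and ‖f'(x)‖ ≤ M_f for every x ∈ ℝⁿ, and h := (μ/2)·‖·‖², such that: φ := f + h attains its minimum φ* on ℝⁿ, the distance from x₀ to the set of minimizers of φ is at most R₀, and for every sequence {x_j}_{j ≥ 0} in ℝⁿ starting from this x₀ that satisfies the linear-span condition x_j ∈ x₀ + span{ f'(x₀), …, f'(x_{j−1}), ∇h(x₀), …, ∇h(x_{j−1}) } for every j ≥ 1, one has φ(x_k) − φ* > ε̄ for every index k with k < ⌊ min{ M_f²·R₀²/(128·ε̄²) , M_f²/(8·μ·ε̄) } ⌋ (the second minimand interpreted as +∞ when μ = 0). Consequently, any such method must generate at least ⌊ min{ M_f²·R₀²/(128·ε̄²) , M_f²/(8·μ·ε̄) } ⌋ + 1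 iterates before producing an ε̄-solution of min φ. -/
open scoped RealInnerProductSpace

noncomputable section

/-- A real function on a nonempty finite linear order has a first maximizer. -/
lemma exists_first_max {ι : Type*} [Finite ι] [Nonempty ι] [LinearOrder ι] (x : ι → ℝ) :
    ∃ i, (∀ j, x j ≤ x i) ∧ ∀ j, x i ≤ x j → i ≤ j := by
  obtain ⟨m, hm⟩ := Finite.exists_max x
  obtain ⟨i, hi, hmin⟩ := (wellFounded_lt (α := ι)).has_min {i | ∀ j, x j ≤ x i} ⟨m, hm⟩
  exact ⟨i, hi, fun j hj => not_lt.1 (hmin j fun l => (hi l).trans hj)⟩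

/-- A function with a subgradient at every point is convex. -/
lemma convexOn_univ_of_subgradient {E : Type*} [NormedAddCommGroup E] [InnerProductSpace ℝ E]
    {f : E → ℝ} {f' : E → E} (h : ∀ x u, f x + ⟪f' x, u - x⟫ ≤ f u) :
    ConvexOn ℝ Set.univ f := by
  refine ⟨convex_univ, fun x _ y _ a b ha hb hab => ?_⟩
  set z := a • x + b • y with hz
  have hx := mul_le_mul_of_nonneg_left (h z x) ha
  have hy := mul_le_mul_of_nonneg_left (h z y) hb
  have hin : a * ⟪f' z, x - z⟫ + b * ⟪f' z, y - z⟫ = 0 := by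
    rw [← real_inner_smul_right, ← real_inner_smul_right, ← inner_add_right]
    have : a • (x - z) + b • (y - z) = (1 - (a + b)) • z := by
      rw [hz]; module
    rw [this, hab]; simp
  have hfz : f z = a * f z + b * f z := by rw [← add_mul, hab, one_mul]
  simp only [smul_eq_mul]
  linarith

/-- A depth at which the truncated max function has its minimizer within distance `R0` of the
origin, while its optimal value is below `-ε`. -/
lemma exists_truncation_depth {M mu R0 ε N : ℝ} (hM : 0 < M) (hmu : 0 ≤ mu) (hR0 : 0 < R0)
    (hε : 0 < ε) (hN : 0 < N) (h1 : N ≤ M ^ 2 * R0 ^ 2 / (128 * ε ^ 2))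
    (h2 : mu ≠ 0 → N ≤ M ^ 2 / (8 * mu * ε)) :
    ∃ a : ℝ, 0 < a ∧ N * a ^ 2 ≤ R0 ^ 2 ∧ mu * N * a ≤ M ∧ 2 * ε < M * a := by
  have hs : 0 < √N := Real.sqrt_pos.2 hN
  have hsq : √N ^ 2 = N := Real.sq_sqrt hN.le
  have hb : N * (R0 / √N) ^ 2 = R0 ^ 2 := by
    rw [div_pow, hsq]; field_simp
  have hbε : 2 * ε < M * (R0 / √N) := by
    rw [le_div_iff₀ (by positivity)] at h1
    refine lt_of_pow_lt_pow_left₀ 2 (by positivity) ?_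
    rw [mul_pow, mul_pow, div_pow, hsq, ← mul_div_assoc, lt_div_iff₀ hN]
    nlinarith [mul_pos hN (pow_pos hε 2)]
  rcases hmu.eq_or_lt with rfl | hmu
  · exact ⟨R0 / √N, by positivity, hb.le, by simpa using hM.le, hbε⟩
  · have hcε : 2 * ε < M * (M / (mu * N)) := by
      have h := h2 hmu.ne'
      rw [le_div_iff₀ (by positivity)] at h
      rw [← mul_div_assoc, lt_div_iff₀ (by positivity)]
      nlinarith [mul_pos (mul_pos hmu hN) hε]
    refine ⟨min (R0 / √N) (M / (mu * N)), by positivity, ?_, ?_, ?_⟩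
    · rw [← hb]
      gcongr
      exact min_le_left _ _
    · have h := min_le_right (R0 / √N) (M / (mu * N))
      rw [le_div_iff₀ (by positivity)] at h
      linarith
    · rcases min_choice (R0 / √N) (M / (mu * N)) with h | h <;> rw [h] <;> assumption

/-- The point `-a • 1` minimizes `M * max (max_i u i) (-a) + mu / 2 * ‖u‖ ^ 2`, provided the
unconstrained minimizer along the diagonal lies no closer to the origin. -/
lemma truncated_max_lower_bound {M mu a m : ℝ} {N : ℕ} (hM : 0 ≤ M) (hmu : 0 ≤ mu) (ha : 0 ≤ a)
    (hMa : mu * N * a ≤ M) {u : EuclideanSpace ℝ (Fin N)} (hum : ∀ i, u i ≤ m) (hm : -a ≤ m) :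
    M * -a + mu / 2 * (N * a ^ 2) ≤ M * m + mu / 2 * ‖u‖ ^ 2 := by
  rcases le_total 0 m with h0 | h0
  · have : 0 ≤ M * m + mu / 2 * ‖u‖ ^ 2 := by positivity
    nlinarith [mul_nonneg hM ha]
  · have hu : N * m ^ 2 ≤ ‖u‖ ^ 2 := by
      rw [EuclideanSpace.real_norm_sq_eq]
      calc N * m ^ 2 = ∑ _i : Fin N, m ^ 2 := by simp
        _ ≤ _ := Finset.sum_le_sum fun i _ => by nlinarith [hum i]
    have h1 := mul_le_mul_of_nonneg_left hu (div_nonneg hmu zero_le_two)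
    have h2 := mul_nonneg (sub_nonneg.2 hMa) (by linarith : 0 ≤ a + m)
    have h3 := mul_nonneg (mul_nonneg hmu (Nat.cast_nonneg (α := ℝ) N)) (sq_nonneg (a + m))
    linarith

/-- Linear-span iterates of an oracle revealing at most one new coordinate per call stay in the
coordinate subspaces spanned by the leading coordinates. -/
lemma apply_eq_zero_of_span_condition {N : ℕ} {mu : ℝ}
    {f' : EuclideanSpace ℝ (Fin N) → EuclideanSpace ℝ (Fin N)}
    (hf' : ∀ (k : ℕ) (x : EuclideanSpace ℝ (Fin N)), (∀ i : Fin N, k ≤ i → x i = 0) →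
      ∀ i : Fin N, k + 1 ≤ i → f' x i = 0)
    {xseq : ℕ → EuclideanSpace ℝ (Fin N)} (h0 : xseq 0 = 0)
    (hspan : ∀ j : ℕ, 1 ≤ j → xseq j - 0 ∈ Submodule.span ℝ
      ((fun i => f' (xseq i)) '' Set.Iio j ∪ (fun i => mu • xseq i) '' Set.Iio j))
    (k : ℕ) : ∀ i : Fin N, k ≤ i → xseq k i = 0 := by
  induction k using Nat.strong_induction_on with
  | _ k ih =>
    intro i hi
    rcases Nat.eq_zero_or_pos k with rfl | hk
    · simp [h0]
    · have hx := hspan k hk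
      rw [sub_zero] at hx
      generalize xseq k = x at hx ⊢
      induction hx using Submodule.span_induction with
      | mem y hy =>
        rcases hy with ⟨j, hj, rfl⟩ | ⟨j, hj, rfl⟩
        · exact hf' j _ (ih j hj) i (le_trans hj hi)
        · simp [ih j hj i (le_trans (le_of_lt hj) hi)]
      | zero => rfl
      | add y z _ _ hy hz => simp [hy, hz]
      | smul c y _ hy => simp [hy]

/-- **lower complexity bound.** For any
`(M_f, μ, R₀, ε̄) ∈ ℝ₊ × ℝ₊ × ℝ₊₊ × ℝ₊₊` there exist a dimension `n ≥ 1`, a point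
`x₀ ∈ ℝⁿ`, a finite-valued convex function `f` with subgradient selection `f'`
bounded in norm by `M_f`, and `h := (μ/2)·‖·‖²`, such that `φ := f + h` attains
its minimum at some `xs` with `‖x₀ − xs‖ ≤ R₀`, and every sequence starting from
`x₀` and satisfying the linear-span condition
`x_j ∈ x₀ + span{f'(x₀), …, f'(x_{j−1}), ∇h(x₀), …, ∇h(x_{j−1})}` satisfies
`φ(x_k) − φ* > ε̄` for every `k < ⌊min{M_f²R₀²/(128ε̄²), M_f²/(8με̄)}⌋` (the second
minimand read as `+∞`, i.e. as the first minimand, when `μ = 0`); consequently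
any such method needs at least `⌊min{…}⌋ + 1` iterates to reach an
`ε̄`-solution. -/
theorem lower_complexity_bound (Mf mu R0 ε : ℝ) (hMf : 0 ≤ Mf) (hmu : 0 ≤ mu)
    (hR0 : 0 < R0) (hε : 0 < ε) :
    ∃ (N : ℕ) (x0 : EuclideanSpace ℝ (Fin N)) (f : EuclideanSpace ℝ (Fin N) → ℝ)
      (f' : EuclideanSpace ℝ (Fin N) → EuclideanSpace ℝ (Fin N))
      (xs : EuclideanSpace ℝ (Fin N)),
      1 ≤ N ∧
      ConvexOn ℝ Set.univ f ∧
      (∀ x u : EuclideanSpace ℝ (Fin N), f x + ⟪f' x, u - x⟫ ≤ f u) ∧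
      (∀ x : EuclideanSpace ℝ (Fin N), ‖f' x‖ ≤ Mf) ∧
      (∀ u : EuclideanSpace ℝ (Fin N),
        f xs + mu / 2 * ‖xs‖ ^ 2 ≤ f u + mu / 2 * ‖u‖ ^ 2) ∧
      ‖x0 - xs‖ ≤ R0 ∧
      ∀ xseq : ℕ → EuclideanSpace ℝ (Fin N), xseq 0 = x0 →
        (∀ j : ℕ, 1 ≤ j → xseq j - x0 ∈ Submodule.span ℝ
          ((fun i => f' (xseq i)) '' Set.Iio j ∪
            (fun i => mu • xseq i) '' Set.Iio j)) →
        (∀ k : ℕ, (k : ℤ) <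
            ⌊min (Mf ^ 2 * R0 ^ 2 / (128 * ε ^ 2))
              (if mu = 0 then Mf ^ 2 * R0 ^ 2 / (128 * ε ^ 2)
               else Mf ^ 2 / (8 * mu * ε))⌋ →
          ε < f (xseq k) + mu / 2 * ‖xseq k‖ ^ 2 -
            (f xs + mu / 2 * ‖xs‖ ^ 2)) ∧
        (∀ k : ℕ,
          f (xseq k) + mu / 2 * ‖xseq k‖ ^ 2 - (f xs + mu / 2 * ‖xs‖ ^ 2) ≤ ε →
          ⌊min (Mf ^ 2 * R0 ^ 2 / (128 * ε ^ 2))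
            (if mu = 0 then Mf ^ 2 * R0 ^ 2 / (128 * ε ^ 2)
             else Mf ^ 2 / (8 * mu * ε))⌋ ≤ (k : ℤ)) := by
  set K := ⌊min (Mf ^ 2 * R0 ^ 2 / (128 * ε ^ 2))
    (if mu = 0 then Mf ^ 2 * R0 ^ 2 / (128 * ε ^ 2) else Mf ^ 2 / (8 * mu * ε))⌋ with hK
  rcases le_or_gt K 0 with hK0 | hK0
  · refine ⟨1, 0, fun _ => 0, fun _ => 0, 0, le_rfl, convexOn_const 0 convex_univ, ?_, ?_, ?_, ?_,
      fun _ _ _ => ⟨?_, ?_⟩⟩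
    · simp
    · simpa using hMf
    · intro u
      simp only [norm_zero]
      have : 0 ≤ mu / 2 * ‖u‖ ^ 2 := by positivity
      simpa using this
    · simpa using hR0.le
    · intro k hk
      omega
    · intro k _
      omega
  obtain ⟨N, hN⟩ := Int.eq_ofNat_of_zero_le hK0.le
  have hNpos : 0 < N := by omega
  have : NeZero N := ⟨hNpos.ne'⟩
  have hNR : (0 : ℝ) < N := by exact_mod_cast hNpos
  have hKle := Int.floor_le (min (Mf ^ 2 * R0 ^ 2 / (128 * ε ^ 2))
    (if mu = 0 then Mf ^ 2 * R0 ^ 2 / (128 * ε ^ 2) else Mf ^ 2 / (8 * mu * ε)))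
  rw [← hK, hN, Int.cast_natCast, le_min_iff] at hKle
  obtain ⟨hle1, hle2⟩ := hKle
  have hMpos : 0 < Mf := by
    refine hMf.lt_of_ne fun h => ?_
    rw [← h] at hle1
    simp only [ne_eq, OfNat.ofNat_ne_zero, not_false_eq_true, zero_pow, zero_mul, zero_div] at hle1
    linarith
  obtain ⟨a, ha, haR, haM, haε⟩ := exists_truncation_depth hMpos hmu hR0 hε hNR hle1
    fun h => by simpa [h] using hle2
  choose idx hmax hfirst using fun x : EuclideanSpace ℝ (Fin N) => exists_first_max x
  set f : EuclideanSpace ℝ (Fin N) → ℝ := fun x => Mf * max (x (idx x)) (-a) with hf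
  set f' : EuclideanSpace ℝ (Fin N) → EuclideanSpace ℝ (Fin N) := fun x =>
    if x (idx x) ≤ -a then 0 else EuclideanSpace.single (idx x) Mf with hf'
  set xs : EuclideanSpace ℝ (Fin N) := WithLp.toLp 2 fun _ => -a with hxs
  have hsub : ∀ x u, f x + ⟪f' x, u - x⟫ ≤ f u := by
    intro x u
    simp only [hf, hf']
    split_ifs with h
    · rw [max_eq_right h, inner_zero_left, add_zero]
      gcongr
      exact le_max_right _ _
    · rw [max_eq_left (not_le.1 h).le, EuclideanSpace.inner_single_left]
      have : Mf * u (idx x) ≤ Mf * max (u (idx u)) (-a) := by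
        gcongr
        exact (hmax u _).trans (le_max_left _ _)
      simpa [mul_sub] using this
  have hnorm : ‖xs‖ ^ 2 = N * a ^ 2 := by
    rw [EuclideanSpace.real_norm_sq_eq]
    simp [hxs]
  have hfxs : f xs = Mf * -a := by simp [hf, hxs]
  refine ⟨N, 0, f, f', xs, hNpos, convexOn_univ_of_subgradient hsub, hsub, ?_, ?_, ?_, ?_⟩
  · intro x
    simp only [hf']
    split_ifs
    · simpa using hMf
    · simp [abs_of_nonneg hMf]
  · intro u
    rw [hfxs, hnorm]
    exact truncated_max_lower_bound hMf hmu ha.le haM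
      (fun i => (hmax u i).trans (le_max_left _ _)) (le_max_right _ _)
  · rw [zero_sub, norm_neg]
    exact le_of_sq_le_sq (hnorm.trans_le haR) hR0.le
  · intro xseq h0 hspan
    have hzero := apply_eq_zero_of_span_condition (f' := f') (fun k x hx i hi => by
      simp only [hf']
      split_ifs with h
      · rfl
      · rw [PiLp.single_apply, if_neg]
        rintro rfl
        have hk : k < N := by omega
        have := hfirst x ⟨k, hk⟩ (by rw [hx (idx x) (by omega), hx ⟨k, hk⟩ le_rfl])
        rw [Fin.le_def] at this
        simp only at this
        omega) h0 hspan
    have hgap : ∀ k : ℕ, (k : ℤ) < K →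
        ε < f (xseq k) + mu / 2 * ‖xseq k‖ ^ 2 - (f xs + mu / 2 * ‖xs‖ ^ 2) := by
      intro k hk
      have hkN : k < N := by omega
      have hmx := hmax (xseq k) ⟨k, hkN⟩
      rw [hzero k ⟨k, hkN⟩ le_rfl] at hmx
      have hfk : 0 ≤ f (xseq k) := mul_nonneg hMf (hmx.trans (le_max_left _ _))
      have hhk : 0 ≤ mu / 2 * ‖xseq k‖ ^ 2 := by positivity
      rw [hfxs, hnorm]
      nlinarith [mul_le_mul_of_nonneg_right haM ha.le]
    exact ⟨hgap, fun k hk => not_lt.1 fun h => (hgap k h).not_ge hk⟩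
end
end

section
/- Consider the constant-stepsize composite subgradient (CS-CS) method with initial point x₀ ∈ dom h and stepsize λ satisfying λ ≤ ε̄/(4·M_f²) for a given tolerance ε̄ > 0. Then the number of iterations performed until it finds an iterate x_j with φ(x_j) − φ* ≤ ε̄ is at most ⌊ min{ d₀²/(λ·ε̄) , ((1 + λμ)/(λμ))·log( μ·d₀²/ε̄ + 1 ) } ⌋ + 1 (the second minimand interpreted as the first when μ = 0); i.e., there exists 1 ≤ j ≤ that bound with φ(x_j) − φ* ≤ ε̄. -/
open scoped RealInnerProductSpace

noncomputable section

section ProxStep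

variable {E : Type*} [NormedAddCommGroup E] [InnerProductSpace ℝ E]

theorem norm_sq_convex_comb_sub (y u p : E) (t : ℝ) :
    ‖(1 - t) • y + t • u - p‖ ^ 2 =
      (1 - t) * ‖y - p‖ ^ 2 + t * ‖u - p‖ ^ 2 - (1 - t) * t * ‖y - u‖ ^ 2 := by
  have h1 : (1 - t) • y + t • u - p = (1 - t) • (y - p) + t • (u - p) := by module
  have h2 : y - u = (y - p) - (u - p) := by abel
  rw [h1, h2, norm_add_sq_real, norm_sub_sq_real (y - p), norm_smul, norm_smul, mul_pow, mul_pow,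
    inner_smul_left, inner_smul_right, Real.norm_eq_abs, Real.norm_eq_abs, sq_abs, sq_abs]
  simp only [conj_trivial]
  ring

theorem le_of_forall_one_sub_mul_le {a b : ℝ} (h : ∀ t : ℝ, 0 < t → t < 1 → (1 - t) * a ≤ b) :
    a ≤ b := by
  have hlim : Filter.Tendsto (fun t : ℝ => (1 - t) * a) (nhdsWithin 0 (Set.Ioi 0)) (nhds a) := by
    have hc : Continuous fun t : ℝ => (1 - t) * a := by fun_prop
    simpa using (hc.tendsto 0).mono_left nhdsWithin_le_nhds
  refine le_of_tendsto hlim ?_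
  filter_upwards [Ioo_mem_nhdsGT (zero_lt_one : (0 : ℝ) < 1)] with t ht
  exact h t ht.1 ht.2

/-- The minimizer of a linear function plus a `mu`-convex function plus a proximal term satisfies
the quadratic growth inequality with modulus `mu + 1 / lam`. -/
theorem prox_step_growth {s : Set E} {h : E → ℝ} {g p y : E} {mu lam : ℝ} (hs : Convex ℝ s)
    (hstrong : ∀ u ∈ s, ∀ v ∈ s, ∀ a b : ℝ, 0 ≤ a → 0 ≤ b → a + b = 1 →
      h (a • u + b • v) ≤ a * h u + b * h v - a * b * mu / 2 * ‖u - v‖ ^ 2)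
    (hy : y ∈ s)
    (hmin : ∀ u ∈ s, ⟪g, y - p⟫ + h y + ‖y - p‖ ^ 2 / (2 * lam) ≤
      ⟪g, u - p⟫ + h u + ‖u - p‖ ^ 2 / (2 * lam))
    {u : E} (hu : u ∈ s) :
    ⟪g, y - p⟫ + h y + ‖y - p‖ ^ 2 / (2 * lam) + (mu / 2 + 1 / (2 * lam)) * ‖y - u‖ ^ 2 ≤
      ⟪g, u - p⟫ + h u + ‖u - p‖ ^ 2 / (2 * lam) := by
  rw [← le_sub_iff_add_le']
  refine le_of_forall_one_sub_mul_le fun t ht0 ht1 => ?_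
  have ht1' : 0 ≤ 1 - t := by linarith
  have hm := hmin _ (hs hy hu ht1' ht0.le (by ring))
  have hc := hstrong y hy u hu (1 - t) t ht1' ht0.le (by ring)
  have hlin : ⟪g, (1 - t) • y + t • u - p⟫ = (1 - t) * ⟪g, y - p⟫ + t * ⟪g, u - p⟫ := by
    rw [← real_inner_smul_right, ← real_inner_smul_right, ← inner_add_right]
    congr 1
    module
  rw [norm_sq_convex_comb_sub, hlin] at hm
  refine le_of_mul_le_mul_left ?_ ht0
  simp only [div_eq_mul_inv] at *
  linear_combination hm + hc

/-- One step of the composite subgradient method with a `2 * M`-bounded subgradient variation. -/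
theorem composite_subgradient_step {s : Set E} {f h : E → ℝ} {f' : E → E} {p y z : E}
    {M mu lam ε : ℝ} (hs : Convex ℝ s) (hlam : 0 < lam)
    (hsub : ∀ u ∈ s, ∀ v ∈ s, f u + ⟪f' u, v - u⟫ ≤ f v)
    (hM : ∀ u ∈ s, ‖f' u‖ ≤ M)
    (hstrong : ∀ u ∈ s, ∀ v ∈ s, ∀ a b : ℝ, 0 ≤ a → 0 ≤ b → a + b = 1 →
      h (a • u + b • v) ≤ a * h u + b * h v - a * b * mu / 2 * ‖u - v‖ ^ 2)
    (hp : p ∈ s) (hy : y ∈ s) (hz : z ∈ s)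
    (hmin : ∀ u ∈ s, f p + ⟪f' p, y - p⟫ + h y + ‖y - p‖ ^ 2 / (2 * lam) ≤
      f p + ⟪f' p, u - p⟫ + h u + ‖u - p‖ ^ 2 / (2 * lam))
    (hstep : 4 * lam * M ^ 2 ≤ ε) :
    2 * lam * (f y + h y - (f z + h z)) + (1 + lam * mu) * ‖y - z‖ ^ 2 ≤
      ‖p - z‖ ^ 2 + lam * ε := by
  have hg := prox_step_growth (g := f' p) hs hstrong hy
    (fun u hu => by linarith [hmin u hu]) hz
  have hz' := hsub p hp z hz
  have hyp := hsub y hy p hp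
  have hgrad : ⟪f' y, y - p⟫ - ⟪f' p, y - p⟫ ≤ 2 * M * ‖y - p‖ := by
    rw [← inner_sub_left]
    refine (real_inner_le_norm _ _).trans ?_
    gcongr
    linarith [norm_sub_le (f' y) (f' p), hM y hy, hM p hp]
  have hneg : ⟪f' y, p - y⟫ = -⟪f' y, y - p⟫ := by rw [← inner_neg_right, neg_sub]
  rw [norm_sub_rev z p] at hg
  have hg' : 2 * lam * (⟪f' p, y - p⟫ + h y) + ‖y - p‖ ^ 2 + (1 + lam * mu) * ‖y - z‖ ^ 2 ≤
      2 * lam * (⟪f' p, z - p⟫ + h z) + ‖p - z‖ ^ 2 := by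
    have := mul_le_mul_of_nonneg_left hg (by positivity : 0 ≤ 2 * lam)
    field_simp at this
    linarith
  have hf : f y - f z ≤ ⟪f' p, y - p⟫ - ⟪f' p, z - p⟫ + 2 * M * ‖y - p‖ := by linarith
  have hf' := mul_le_mul_of_nonneg_left hf (by positivity : 0 ≤ 2 * lam)
  have hε := mul_le_mul_of_nonneg_left hstep hlam.le
  linarith [sq_nonneg (‖y - p‖ - 2 * lam * M)]

end ProxStep

/-- If `(1 + lam * mu) * d (j + 1) + lam * ε ≤ d j` holds for `j < k`, then `k` is bounded by
the iteration count of the composite subgradient method. -/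
theorem le_min_of_contraction {d : ℕ → ℝ} {mu lam ε : ℝ} {k : ℕ} (hd : ∀ j, 0 ≤ d j)
    (hmu : 0 ≤ mu) (hlam : 0 < lam) (hε : 0 < ε)
    (hrec : ∀ j < k, (1 + lam * mu) * d (j + 1) + lam * ε ≤ d j) :
    (k : ℝ) ≤ min (d 0 / (lam * ε))
      (if mu = 0 then d 0 / (lam * ε)
       else (1 + lam * mu) / (lam * mu) * Real.log (mu * d 0 / ε + 1)) := by
  have hlin : (k : ℝ) ≤ d 0 / (lam * ε) := by
    have key : ∀ j ≤ k, d j + j * (lam * ε) ≤ d 0 := by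
      intro j
      induction j with
      | zero => simp
      | succ j ih =>
        intro hj
        have h1 := ih (by omega)
        have h2 := hrec j (by omega)
        have h3 : 0 ≤ lam * mu * d (j + 1) := mul_nonneg (by positivity) (hd _)
        push_cast
        linarith
    rw [le_div_iff₀ (by positivity)]
    linarith [key k le_rfl, hd k]
  refine le_min hlin ?_
  split_ifs with h0
  · exact hlin
  have hmu' : 0 < mu := lt_of_le_of_ne hmu (Ne.symm h0)
  have hlm : 0 < lam * mu := by positivity
  have key : ∀ j ≤ k, (1 + lam * mu) ^ j * (mu * d j + ε) ≤ mu * d 0 + ε := by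
    intro j
    induction j with
    | zero => simp
    | succ j ih =>
      intro hj
      refine le_trans ?_ (ih (by omega))
      rw [pow_succ, mul_assoc]
      gcongr
      linarith [mul_le_mul_of_nonneg_left (hrec j (by omega)) hmu]
  have hpow : (1 + lam * mu) ^ k ≤ mu * d 0 / ε + 1 := by
    rw [div_add_one hε.ne', le_div_iff₀ hε]
    refine le_trans ?_ (key k le_rfl)
    gcongr
    linarith [mul_nonneg hmu (hd k)]
  have hlog := Real.log_le_log (by positivity) hpow
  rw [Real.log_pow] at hlog
  have hone : lam * mu / (1 + lam * mu) ≤ Real.log (1 + lam * mu) := by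
    have := Real.one_sub_inv_le_log_of_pos (by positivity : 0 < 1 + lam * mu)
    refine le_trans (le_of_eq ?_) this
    field_simp
    ring
  calc (k : ℝ) = (1 + lam * mu) / (lam * mu) * (k * (lam * mu / (1 + lam * mu))) := by
        field_simp
    _ ≤ (1 + lam * mu) / (lam * mu) * Real.log (mu * d 0 / ε + 1) := by
        gcongr
        exact (mul_le_mul_of_nonneg_left hone k.cast_nonneg).trans hlog

/-- **CS-CS complexity.** Consider the constant-stepsize
composite subgradient method `x_j := argmin_u {f(x_{j−1}) + ⟨f'(x_{j−1}),
u − x_{j−1}⟩ + h(u) + ‖u − x_{j−1}‖²/(2λ)}` with `x₀ ∈ dom h` and stepsize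
`λ ≤ ε̄/(4M_f²)`.  Then an iterate `x_j` with `φ(x_j) − φ* ≤ ε̄` is found after
at most `⌊min{d₀²/(λε̄), ((1+λμ)/(λμ))·log(μd₀²/ε̄ + 1)}⌋ + 1` iterations (the
second minimand read as the first when `μ = 0`). -/
theorem cscs_complexity {n : ℕ}
    (f h : EuclideanSpace ℝ (Fin n) → ℝ)
    (domH : Set (EuclideanSpace ℝ (Fin n)))
    (f' : EuclideanSpace ℝ (Fin n) → EuclideanSpace ℝ (Fin n))
    (Mf mu lam ε : ℝ) (xstar : EuclideanSpace ℝ (Fin n))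
    (x : ℕ → EuclideanSpace ℝ (Fin n))
    (hMf : 0 ≤ Mf) (hmu : 0 ≤ mu) (hlam : 0 < lam) (hε : 0 < ε)
    (hdom : Convex ℝ domH) (hdomc : IsClosed domH)
    (hf : ConvexOn ℝ domH f) (hh : ConvexOn ℝ domH h)
    (hsub : ∀ u ∈ domH, ∀ v ∈ domH, f u + ⟪f' u, v - u⟫ ≤ f v)
    (hMfb : ∀ u ∈ domH, ‖f' u‖ ≤ Mf)
    (hstrong : ∀ u ∈ domH, ∀ v ∈ domH, ∀ a b : ℝ, 0 ≤ a → 0 ≤ b → a + b = 1 →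
      h (a • u + b • v) ≤ a * h u + b * h v - a * b * mu / 2 * ‖u - v‖ ^ 2)
    (hx0 : x 0 ∈ domH)
    (hxs : xstar ∈ domH)
    (hopt : ∀ u ∈ domH, f xstar + h xstar ≤ f u + h u)
    (hclosest : ∀ u ∈ domH, (∀ v ∈ domH, f u + h u ≤ f v + h v) →
      ‖x 0 - xstar‖ ≤ ‖x 0 - u‖)
    (hmem : ∀ j : ℕ, 1 ≤ j → x j ∈ domH)
    (hmin : ∀ j : ℕ, 1 ≤ j → ∀ u ∈ domH,
      f (x (j - 1)) + ⟪f' (x (j - 1)), x j - x (j - 1)⟫ + h (x j) +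
          ‖x j - x (j - 1)‖ ^ 2 / (2 * lam) ≤
        f (x (j - 1)) + ⟪f' (x (j - 1)), u - x (j - 1)⟫ + h u +
          ‖u - x (j - 1)‖ ^ 2 / (2 * lam))
    (hstep : lam ≤ ε / (4 * Mf ^ 2)) :
    ∃ j : ℕ, 1 ≤ j ∧
      (j : ℤ) ≤ ⌊min (‖x 0 - xstar‖ ^ 2 / (lam * ε))
          (if mu = 0 then ‖x 0 - xstar‖ ^ 2 / (lam * ε)
           else (1 + lam * mu) / (lam * mu) *
             Real.log (mu * ‖x 0 - xstar‖ ^ 2 / ε + 1))⌋ + 1 ∧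
      f (x j) + h (x j) - (f xstar + h xstar) ≤ ε := by
  have hMpos : 0 < Mf := by
    rcases hMf.eq_or_lt with h0 | h0
    · rw [← h0] at hstep
      norm_num at hstep
      linarith
    · exact h0
  have hstep' : 4 * lam * Mf ^ 2 ≤ ε := by
    rw [le_div_iff₀ (by positivity)] at hstep
    linarith
  have hmem' : ∀ j, x j ∈ domH := fun j => by
    rcases Nat.eq_zero_or_pos j with rfl | hj
    · exact hx0
    · exact hmem j hj
  set B := min (‖x 0 - xstar‖ ^ 2 / (lam * ε))
    (if mu = 0 then ‖x 0 - xstar‖ ^ 2 / (lam * ε)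
     else (1 + lam * mu) / (lam * mu) * Real.log (mu * ‖x 0 - xstar‖ ^ 2 / ε + 1)) with hB
  have hBnn : 0 ≤ B := by
    exact Nat.cast_zero.ge.trans <|
      le_min_of_contraction (d := fun j => ‖x j - xstar‖ ^ 2) (k := 0)
        (fun _ => by positivity) hmu hlam hε (by simp)
  have hcast : ((⌊B⌋₊ : ℕ) : ℤ) = ⌊B⌋ := Int.natCast_floor_eq_floor hBnn
  by_contra! hcon
  have hle := le_min_of_contraction (d := fun j => ‖x j - xstar‖ ^ 2) (k := ⌊B⌋₊ + 1)
    (fun _ => by positivity) hmu hlam hε (by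
      intro j hj
      have hgap := hcon (j + 1) (by omega) (by push_cast; omega)
      have hdesc := composite_subgradient_step hdom hlam hsub hMfb hstrong (hmem' j)
        (hmem' (j + 1)) hxs (hmin (j + 1) (by omega)) hstep'
      have := mul_le_mul_of_nonneg_left hgap.le hlam.le
      linarith)
  have hlt := Nat.lt_floor_add_one B
  push_cast at hle
  exact absurd hle (not_le.mpr hlt)
end
end
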